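/- arXiv:2602.21804 — 2 statements merged into one kernel-verified Lean document; each statement's English description precedes it below -/
import Mathlib

section
/- For any function u in H^2 of the 2-dimensional torus T^2 with zero mean (∫_{T^2} u dx = 0), there exists a universal constant C > 0 such that ‖u‖_{L^∞(T^2)} ≤ C ‖∇u‖_{L^2(T^2)} (1 + |log(‖Δu‖_{L^2(T^2)} / ‖∇u‖_{L^2(T^2)})|), provided ∇u is not identically zero. -/
open MeasureTheory Real Set

noncomputable section

/-- Fundamental domain of the torus `T² = ℝ²/ℤ²` (unit measure). -/
def Qd : Set (ℝ × ℝ) := Set.Ioc 0 1 ×ˢ Set.Ioc 0 1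

/-- `ℤ²`-periodicity: functions on the torus. -/
def Per {α : Type*} (f : ℝ × ℝ → α) : Prop :=
  ∀ x : ℝ × ℝ, f (x.1 + 1, x.2) = f x ∧ f (x.1, x.2 + 1) = f x

/-- First partial derivative. -/
def d1 (f : ℝ × ℝ → ℝ) (x : ℝ × ℝ) : ℝ := fderiv ℝ f x (1, 0)

/-- Second partial derivative. -/
def d2 (f : ℝ × ℝ → ℝ) (x : ℝ × ℝ) : ℝ := fderiv ℝ f x (0, 1)

/-- Laplacian. -/
def lap (f : ℝ × ℝ → ℝ) (x : ℝ × ℝ) : ℝ := d1 (d1 f) x + d2 (d2 f) x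

/-- Squared length of the gradient. -/
def gradSq (f : ℝ × ℝ → ℝ) (x : ℝ × ℝ) : ℝ := (d1 f x) ^ 2 + (d2 f x) ^ 2

section helpers

lemma cont_inner {f : ℝ → ℝ → ℝ} (hf : Continuous (Function.uncurry f)) (a b : ℝ) :
    Continuous fun x => ∫ y in a..b, f x y :=
  intervalIntegral.continuous_parametric_intervalIntegral_of_continuous' hf a b

lemma swap_cont {f : ℝ → ℝ → ℝ} (hf : Continuous (Function.uncurry f)) (a b c d : ℝ) :
    ∫ x in a..b, ∫ y in c..d, f x y = ∫ y in c..d, ∫ x in a..b, f x y := by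
  apply MeasureTheory.intervalIntegral_intervalIntegral_swap
  have h : IntegrableOn (Function.uncurry f) (uIcc a b ×ˢ uIcc c d) :=
    hf.continuousOn.integrableOn_compact (isCompact_uIcc.prod isCompact_uIcc)
  exact h.mono_set (Set.prod_mono uIoc_subset_uIcc uIoc_subset_uIcc)

lemma rect_int {f : ℝ × ℝ → ℝ} (hf : Continuous f) {a b c d : ℝ} (hab : a ≤ b) (hcd : c ≤ d) :
    ∫ x in Ioc a b ×ˢ Ioc c d, f x = ∫ x in a..b, ∫ y in c..d, f (x, y) := by
  have h : IntegrableOn f (Icc a b ×ˢ Icc c d) :=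
    hf.continuousOn.integrableOn_compact (isCompact_Icc.prod isCompact_Icc)
  rw [Measure.volume_eq_prod, setIntegral_prod]
  · rw [intervalIntegral.integral_of_le hab]
    simp_rw [intervalIntegral.integral_of_le hcd]
  · exact h.mono_set (Set.prod_mono Ioc_subset_Icc_self Ioc_subset_Icc_self)

lemma Qd_int {f : ℝ × ℝ → ℝ} (hf : Continuous f) :
    ∫ x in Qd, f x = ∫ x in (0:ℝ)..1, ∫ y in (0:ℝ)..1, f (x, y) :=
  rect_int hf zero_le_one zero_le_one

lemma Qd_integrable {f : ℝ × ℝ → ℝ} (hf : Continuous f) : IntegrableOn f Qd := by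
  have h : IntegrableOn f (Icc 0 1 ×ˢ Icc 0 1) :=
    hf.continuousOn.integrableOn_compact (isCompact_Icc.prod isCompact_Icc)
  exact h.mono_set (Set.prod_mono Ioc_subset_Icc_self Ioc_subset_Icc_self)

lemma Qd_meas : MeasurableSet Qd := measurableSet_Ioc.prod measurableSet_Ioc

lemma trans_int {f : ℝ × ℝ → ℝ} (hf : Continuous f) (hp : Per f) (a b : ℝ) :
    ∫ x in Ioc (-(1/2):ℝ) (1/2) ×ˢ Ioc (-(1/2):ℝ) (1/2), f (a + x.1, b + x.2) = ∫ x in Qd, f x := by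
  rw [rect_int (f := fun x : ℝ × ℝ => f (a + x.1, b + x.2)) (by fun_prop) (by norm_num) (by norm_num),
    Qd_int hf]
  have h1 : ∀ x, ∫ y in (-(1/2):ℝ)..(1/2), f (x, b + y) = ∫ y in (0:ℝ)..1, f (x, y) := by
    intro x
    rw [intervalIntegral.integral_comp_add_left (fun y => f (x, y)) b]
    have hper : Function.Periodic (fun y => f (x, y)) 1 := fun y => (hp (x, y)).2
    have := hper.intervalIntegral_add_eq (b + -(1/2)) 0
    rw [show b + -(1/2) + 1 = b + 1/2 by ring, zero_add] at this
    exact this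
  simp only [h1]
  have hper : Function.Periodic (fun x => ∫ y in (0:ℝ)..1, f (x, y)) 1 := fun x => by
    simp only
    congr 1; ext y; exact (hp (x, y)).1
  rw [intervalIntegral.integral_comp_add_left (fun x => ∫ y in (0:ℝ)..1, f (x, y)) a]
  have := hper.intervalIntegral_add_eq (a + -(1/2)) 0
  rw [show a + -(1/2) + 1 = a + 1/2 by ring, zero_add] at this
  exact this

lemma polar_le {f : ℝ × ℝ → ℝ} (hf : Continuous f) (h0 : ∀ x, 0 ≤ f x) :
    ∫ s in (0:ℝ)..(1/2), s * ∫ θ in (-π)..π, f (s * cos θ, s * sin θ) ≤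
      ∫ x in Ioc (-(1/2):ℝ) (1/2) ×ˢ Ioc (-(1/2):ℝ) (1/2), f x := by
  set S : Set (ℝ × ℝ) := Ioc (-(1/2):ℝ) (1/2) ×ˢ Ioc (-(1/2):ℝ) (1/2) with hS
  have hSm : MeasurableSet S := measurableSet_Ioc.prod measurableSet_Ioc
  set B : Set (ℝ × ℝ) := Ioc (0:ℝ) (1/2) ×ˢ Ioc (-π) π with hB
  set B' : Set (ℝ × ℝ) := Ioo (0:ℝ) (1/2) ×ˢ Ioo (-π) π with hB'
  have hBB : B' =ᵐ[volume] B := by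
    rw [hB, hB', Measure.volume_eq_prod]
    exact Measure.set_prod_ae_eq Ioo_ae_eq_Ioc Ioo_ae_eq_Ioc
  have hB'm : MeasurableSet B' := measurableSet_Ioo.prod measurableSet_Ioo
  set g : ℝ × ℝ → ℝ := fun p => p.1 * f (p.1 * cos p.2, p.1 * sin p.2) with hg
  have hgc : Continuous g := by fun_prop
  have e1 : ∫ s in (0:ℝ)..(1/2), s * ∫ θ in (-π)..π, f (s * cos θ, s * sin θ) = ∫ p in B', g p := by
    rw [setIntegral_congr_set hBB, rect_int hgc (by norm_num) (by linarith [pi_pos])]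
    simp [hg]
  have hgi : IntegrableOn g B' := by
    have h : IntegrableOn g (Icc 0 (1/2) ×ˢ Icc (-π) π) :=
      hgc.continuousOn.integrableOn_compact (isCompact_Icc.prod isCompact_Icc)
    exact h.mono_set (Set.prod_mono Ioo_subset_Icc_self Ioo_subset_Icc_self)
  have hfi : IntegrableOn f S := by
    have h : IntegrableOn f (Icc (-(1/2):ℝ) (1/2) ×ˢ Icc (-(1/2):ℝ) (1/2)) :=
      hf.continuousOn.integrableOn_compact (isCompact_Icc.prod isCompact_Icc)
    exact h.mono_set (Set.prod_mono Ioc_subset_Icc_self Ioc_subset_Icc_self)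
  rw [e1]
  have hS0 : 0 ≤ ∫ x in S, f x := integral_nonneg h0
  rw [← ENNReal.ofReal_le_ofReal_iff hS0,
    ofReal_integral_eq_lintegral_ofReal hgi ?_, ofReal_integral_eq_lintegral_ofReal hfi
      (Filter.Eventually.of_forall h0)]
  · rw [← lintegral_indicator hSm, ← lintegral_comp_polarCoord_symm]
    have hsub : B' ⊆ polarCoord.target := by
      rw [polarCoord_target]
      exact Set.prod_mono Ioo_subset_Ioi_self subset_rfl
    refine le_trans ?_ (lintegral_mono_set hsub)
    apply setLIntegral_mono' hB'm
    rintro ⟨s, θ⟩ ⟨hs, -⟩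
    simp only [mem_Ioo] at hs
    have hc := abs_le.1 (abs_cos_le_one θ)
    have hsn := abs_le.1 (abs_sin_le_one θ)
    have hm : (s * cos θ, s * sin θ) ∈ S := by
      refine ⟨⟨?_, ?_⟩, ⟨?_, ?_⟩⟩ <;> simp only <;> nlinarith
    rw [polarCoord_symm_apply]
    simp only [Set.indicator_of_mem hm, smul_eq_mul, hg]
    rw [ENNReal.ofReal_mul hs.1.le]
  · filter_upwards [ae_restrict_mem hB'm] with p hp
    exact mul_nonneg hp.1.1.le (h0 _)

lemma polar_torus {f : ℝ × ℝ → ℝ} (hf : Continuous f) (hp : Per f) (h0 : ∀ x, 0 ≤ f x) (a b : ℝ) :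
    ∫ s in (0:ℝ)..(1/2), s * ∫ θ in (-π)..π, f (a + s * cos θ, b + s * sin θ) ≤
      ∫ x in Qd, f x := by
  rw [← trans_int hf hp a b]
  exact polar_le (f := fun x : ℝ × ℝ => f (a + x.1, b + x.2)) (by fun_prop) (fun x => h0 _)

lemma young_int {h : ℝ → ℝ} (hh : Continuous h) {μ : ℝ} (hμ : 0 < μ) :
    |∫ θ in (-π)..π, h θ| ≤ μ / 2 * (∫ θ in (-π)..π, h θ ^ 2) + π / μ := by
  have hpi := pi_pos
  have hle : (-π) ≤ π := by linarith
  calc |∫ θ in (-π)..π, h θ| ≤ ∫ θ in (-π)..π, |h θ| :=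
        intervalIntegral.abs_integral_le_integral_abs hle
    _ ≤ ∫ θ in (-π)..π, (μ / 2 * h θ ^ 2 + 1 / (2 * μ)) := by
        apply intervalIntegral.integral_mono_on hle
        · exact (hh.abs).intervalIntegrable _ _
        · exact Continuous.intervalIntegrable (by fun_prop) _ _
        · intro x _
          have h1 : 0 ≤ (μ * |h x| - 1) ^ 2 / (2 * μ) := by positivity
          have h2 : (μ * |h x| - 1) ^ 2 / (2 * μ) = μ / 2 * |h x| ^ 2 + 1 / (2 * μ) - |h x| := by
            field_simp; ring
          rw [sq_abs] at h2
          linarith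
    _ = _ := by
        rw [intervalIntegral.integral_add (Continuous.intervalIntegrable (by fun_prop) _ _)
          (Continuous.intervalIntegrable (by fun_prop) _ _), intervalIntegral.integral_const_mul,
          intervalIntegral.integral_const]
        simp only [smul_eq_mul]
        congr 1
        field_simp; ring

lemma d_cont {f : ℝ × ℝ → ℝ} (hf : ContDiff ℝ 1 f) : Continuous (d1 f) ∧ Continuous (d2 f) := by
  have := hf.continuous_fderiv one_ne_zero
  unfold d1 d2
  constructor <;> fun_prop

lemma d_contDiff {f : ℝ × ℝ → ℝ} (hf : ContDiff ℝ 2 f) :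
    ContDiff ℝ 1 (d1 f) ∧ ContDiff ℝ 1 (d2 f) := by
  have h : ContDiff ℝ 1 (fderiv ℝ f) := hf.fderiv_right (by norm_num)
  unfold d1 d2
  constructor <;> exact h.clm_apply contDiff_const

lemma d_per {f : ℝ × ℝ → ℝ} (hp : Per f) : Per (d1 f) ∧ Per (d2 f) := by
  have h1 : ∀ x : ℝ × ℝ, fderiv ℝ f (x.1 + 1, x.2) = fderiv ℝ f x := by
    intro x
    have : (fun y : ℝ × ℝ => f (y + (1, 0))) = f := by
      ext y; have := (hp y).1; simpa [Prod.add_def] using this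
    have h := fderiv_comp_add_right (𝕜 := ℝ) (f := f) (x := x) ((1, 0) : ℝ × ℝ)
    rw [this] at h
    rw [h]; congr 1; simp [Prod.add_def]
  have h2 : ∀ x : ℝ × ℝ, fderiv ℝ f (x.1, x.2 + 1) = fderiv ℝ f x := by
    intro x
    have : (fun y : ℝ × ℝ => f (y + (0, 1))) = f := by
      ext y; have := (hp y).2; simpa [Prod.add_def] using this
    have h := fderiv_comp_add_right (𝕜 := ℝ) (f := f) (x := x) ((0, 1) : ℝ × ℝ)
    rw [this] at h
    rw [h]; congr 1; simp [Prod.add_def]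
  constructor <;> intro x <;> simp only [d1, d2, h1, h2, and_self]

lemma curve_deriv {f : ℝ × ℝ → ℝ} (hf : ContDiff ℝ 1 f) {p q : ℝ → ℝ} {p' q' t : ℝ}
    (hp : HasDerivAt p p' t) (hq : HasDerivAt q q' t) :
    HasDerivAt (fun t => f (p t, q t)) (p' * d1 f (p t, q t) + q' * d2 f (p t, q t)) t := by
  have h := (hf.differentiable one_ne_zero (p t, q t)).hasFDerivAt
  have h2 := h.comp_hasDerivAt t (hp.prodMk hq)
  have e : p' * d1 f (p t, q t) + q' * d2 f (p t, q t) = fderiv ℝ f (p t, q t) (p', q') := by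
    unfold d1 d2
    rw [← smul_eq_mul, ← smul_eq_mul, ← map_smul, ← map_smul, ← map_add]
    simp
  rw [e]
  exact h2

end helpers

section main

/-- Poincare-type inequality in `L¹`. -/
lemma poincare {u : ℝ × ℝ → ℝ} (hu : ContDiff ℝ 1 u) (hm : (∫ x in Qd, u x) = 0) {G : ℝ}
    (hG : 0 < G) (hGG : ∫ x in Qd, gradSq u x = G ^ 2) :
    ∫ x in Qd, |u x| ≤ 3 / 2 * G := by
  obtain ⟨c1, c2⟩ := d_cont hu
  have cu := hu.continuous
  set H : ℝ → ℝ := fun y => ∫ x in (0:ℝ)..1, |d1 u (x, y)| with hH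
  set V : ℝ → ℝ := fun x => ∫ y in (0:ℝ)..1, |d2 u (x, y)| with hV
  have cH : Continuous H := cont_inner (f := fun y x => |d1 u (x, y)|) (by fun_prop) 0 1
  have cV : Continuous V := cont_inner (f := fun x y => |d2 u (x, y)|) (by fun_prop) 0 1
  have sub : ∀ {g : ℝ → ℝ}, Continuous g → ∀ a ∈ Icc (0:ℝ) 1, ∀ b ∈ Icc (0:ℝ) 1,
      |∫ t in a..b, g t| ≤ ∫ t in (0:ℝ)..1, |g t| := by
    intro g hg a ha b hb
    have h1 : |∫ t in a..b, g t| ≤ |(∫ t in a..b, |g t|)| := by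
      simpa only [Real.norm_eq_abs] using
        intervalIntegral.norm_integral_le_abs_integral_norm (f := g) (a := a) (b := b) (μ := volume)
    refine h1.trans ?_
    have h2 := intervalIntegral.abs_integral_mono_interval (f := fun t => |g t|) (a := a) (b := b)
      (c := 0) (d := 1) (μ := volume) ?_ ?_ (hg.abs.intervalIntegrable _ _)
    · refine h2.trans (le_of_eq (abs_of_nonneg ?_))
      exact intervalIntegral.integral_nonneg zero_le_one (fun _ _ => abs_nonneg _)
    · rw [uIoc_of_le zero_le_one]
      exact Set.Ioc_subset_Ioc (le_min ha.1 hb.1) (max_le ha.2 hb.2)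
    · exact Filter.Eventually.of_forall (fun _ => abs_nonneg _)
  have hdiff : ∀ x ∈ Icc (0:ℝ) 1, ∀ y ∈ Icc (0:ℝ) 1, ∀ s ∈ Icc (0:ℝ) 1, ∀ t ∈ Icc (0:ℝ) 1,
      u (x, y) - u (s, t) ≤ H y + V s ∧ -(H y + V s) ≤ u (x, y) - u (s, t) := by
    intro x hx y hy s hs t ht
    have e1 : ∫ ξ in s..x, d1 u (ξ, y) = u (x, y) - u (s, y) := by
      apply intervalIntegral.integral_eq_sub_of_hasDerivAt (f := fun ξ => u (ξ, y))
      · intro ξ _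
        simpa using curve_deriv hu (hasDerivAt_id ξ) (hasDerivAt_const ξ y)
      · exact Continuous.intervalIntegrable (by fun_prop) _ _
    have e2 : ∫ η in t..y, d2 u (s, η) = u (s, y) - u (s, t) := by
      apply intervalIntegral.integral_eq_sub_of_hasDerivAt (f := fun η => u (s, η))
      · intro η _
        simpa using curve_deriv hu (hasDerivAt_const η s) (hasDerivAt_id η)
      · exact Continuous.intervalIntegrable (by fun_prop) _ _
    have b1 := sub (g := fun ξ => d1 u (ξ, y)) (by fun_prop) s hs x hx
    have b2 := sub (g := fun η => d2 u (s, η)) (by fun_prop) t ht y hy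
    rw [e1] at b1
    rw [e2] at b2
    have b1' := abs_le.1 b1
    have b2' := abs_le.1 b2
    simp only [hH, hV]
    constructor <;> linarith [b1'.1, b1'.2, b2'.1, b2'.2]
  set v : ℝ := ∫ s in (0:ℝ)..1, V s with hv
  have vol : ∫ _z in Qd, (1:ℝ) = 1 := by
    rw [Qd_int continuous_const]; simp
  have hvQ : ∫ z in Qd, V z.1 = v := by
    rw [Qd_int (f := fun z : ℝ × ℝ => V z.1) (by fun_prop)]; simp [hv]
  have hHQ : ∫ z in Qd, H z.2 = ∫ z in Qd, |d1 u z| := by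
    rw [Qd_int (f := fun z : ℝ × ℝ => H z.2) (by fun_prop),
      Qd_int (f := fun z : ℝ × ℝ => |d1 u z|) (by fun_prop)]
    simp only [intervalIntegral.integral_const, sub_zero, one_smul]
    exact swap_cont (f := fun y x => |d1 u (x, y)|) (by fun_prop) 0 1 0 1
  have hvQ2 : v = ∫ z in Qd, |d2 u z| := by
    rw [Qd_int (f := fun z : ℝ × ℝ => |d2 u z|) (by fun_prop)]
  have hpt : ∀ z ∈ Qd, |u z| ≤ H z.2 + v := by
    rintro ⟨x, y⟩ ⟨hx, hy⟩
    have hx' := Ioc_subset_Icc_self hx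
    have hy' := Ioc_subset_Icc_self hy
    simp only at hx' hy' ⊢
    have conI : ∀ c : ℝ, ∫ _z in Qd, c = c := by
      intro c
      have := integral_const_mul (μ := volume.restrict Qd) c (fun _ : ℝ × ℝ => (1:ℝ))
      rw [vol] at this
      simpa using this
    have i0 : IntegrableOn (fun _ : ℝ × ℝ => u (x, y)) Qd := Qd_integrable continuous_const
    have i1 : IntegrableOn u Qd := Qd_integrable cu
    have e : ∫ z in Qd, (u (x, y) - u z) = u (x, y) := by
      rw [integral_sub i0 i1, hm, conI, sub_zero]
    have iH : IntegrableOn (fun _ : ℝ × ℝ => H y) Qd := Qd_integrable continuous_const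
    have iV : IntegrableOn (fun z : ℝ × ℝ => V z.1) Qd := Qd_integrable (by fun_prop)
    have eB : ∫ z in Qd, (H y + V z.1) = H y + v := by
      rw [integral_add iH iV, conI, hvQ]
    rw [abs_le]
    constructor
    · rw [← eB, ← integral_neg, ← e]
      apply setIntegral_mono_on (iH.add iV).neg (i0.sub i1) Qd_meas
      rintro ⟨s, t⟩ ⟨hs, ht⟩
      exact (hdiff x hx' y hy' s (Ioc_subset_Icc_self hs) t (Ioc_subset_Icc_self ht)).2
    · rw [← eB, ← e]
      apply setIntegral_mono_on (i0.sub i1) (iH.add iV) Qd_meas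
      rintro ⟨s, t⟩ ⟨hs, ht⟩
      exact (hdiff x hx' y hy' s (Ioc_subset_Icc_self hs) t (Ioc_subset_Icc_self ht)).1
  have iH2 : IntegrableOn (fun z : ℝ × ℝ => H z.2) Qd := Qd_integrable (by fun_prop)
  have iv : IntegrableOn (fun z : ℝ × ℝ => v) Qd := Qd_integrable continuous_const
  have ia1 : IntegrableOn (fun z : ℝ × ℝ => |d1 u z|) Qd := Qd_integrable (by fun_prop)
  have ia2 : IntegrableOn (fun z : ℝ × ℝ => |d2 u z|) Qd := Qd_integrable (by fun_prop)
  have cg : Continuous (gradSq u) := by unfold gradSq; fun_prop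
  calc ∫ x in Qd, |u x| ≤ ∫ z in Qd, (H z.2 + v) :=
        setIntegral_mono_on (Qd_integrable cu.abs) (iH2.add iv) Qd_meas hpt
    _ = ∫ z in Qd, (|d1 u z| + |d2 u z|) := by
        rw [integral_add iH2 iv, integral_add ia1 ia2, hHQ, ← hvQ2]
        have := integral_const_mul (μ := volume.restrict Qd) v (fun _ : ℝ × ℝ => (1:ℝ))
        rw [vol] at this
        simp only [mul_one] at this
        rw [this]
    _ ≤ ∫ z in Qd, (1 / (2 * G) * gradSq u z + G * 1) := by
        apply setIntegral_mono_on (ia1.add ia2) (Qd_integrable (by fun_prop)) Qd_meas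
        intro z _
        have h1 : 0 ≤ ((|d1 u z| - G) ^ 2 + (|d2 u z| - G) ^ 2) / (2 * G) := by positivity
        have h2 : ((|d1 u z| - G) ^ 2 + (|d2 u z| - G) ^ 2) / (2 * G) =
          1 / (2 * G) * (|d1 u z| ^ 2 + |d2 u z| ^ 2) + G * 1 - (|d1 u z| + |d2 u z|) := by
          field_simp; ring
        rw [sq_abs, sq_abs] at h2
        simp only [gradSq, Pi.add_apply]
        linarith
    _ = 3 / 2 * G := by
        rw [integral_add (Qd_integrable (by fun_prop)) (Qd_integrable (by fun_prop)),
          integral_const_mul, integral_const_mul, hGG, vol]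
        field_simp; ring

/-- Radial fundamental theorem, integrated over the angle. -/
lemma radial_one {u : ℝ × ℝ → ℝ} (hu : ContDiff ℝ 1 u) (a b r : ℝ) :
    ∫ θ in (-π)..π, u (a + r * cos θ, b + r * sin θ) = 2 * π * u (a, b) +
      ∫ s in (0:ℝ)..r, ∫ θ in (-π)..π, (cos θ * d1 u (a + s * cos θ, b + s * sin θ) +
        sin θ * d2 u (a + s * cos θ, b + s * sin θ)) := by
  obtain ⟨c1, c2⟩ := d_cont hu
  have cu := hu.continuous
  rw [swap_cont (f := fun s θ => cos θ * d1 u (a + s * cos θ, b + s * sin θ) +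
        sin θ * d2 u (a + s * cos θ, b + s * sin θ)) (by fun_prop)]
  have h : ∀ θ : ℝ, ∫ s in (0:ℝ)..r, (cos θ * d1 u (a + s * cos θ, b + s * sin θ) +
        sin θ * d2 u (a + s * cos θ, b + s * sin θ)) =
      u (a + r * cos θ, b + r * sin θ) - u (a, b) := by
    intro θ
    rw [intervalIntegral.integral_eq_sub_of_hasDerivAt
      (f := fun s => u (a + s * cos θ, b + s * sin θ))]
    · simp
    · intro s _
      refine curve_deriv hu (p := fun s => a + s * cos θ) (q := fun s => b + s * sin θ) ?_ ?_
      · simpa using ((hasDerivAt_id s).mul_const (cos θ)).const_add a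
      · simpa using ((hasDerivAt_id s).mul_const (sin θ)).const_add b
    · exact Continuous.intervalIntegrable (by fun_prop) _ _
  simp only [h]
  rw [intervalIntegral.integral_sub (Continuous.intervalIntegrable (by fun_prop) _ _)
    (Continuous.intervalIntegrable (by fun_prop) _ _), intervalIntegral.integral_const]
  simp only [smul_eq_mul]; ring

/-- Divergence theorem on the disc in polar form. -/
lemma radial_two {u : ℝ × ℝ → ℝ} (hu : ContDiff ℝ 2 u) (a b r : ℝ) :
    r * ∫ θ in (-π)..π, (cos θ * d1 u (a + r * cos θ, b + r * sin θ) +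
        sin θ * d2 u (a + r * cos θ, b + r * sin θ)) =
      ∫ s in (0:ℝ)..r, s * ∫ θ in (-π)..π, lap u (a + s * cos θ, b + s * sin θ) := by
  obtain ⟨C1, C2⟩ := d_contDiff hu
  obtain ⟨c11, c12⟩ := d_cont C1
  obtain ⟨c21, c22⟩ := d_cont C2
  have c1 := C1.continuous
  have c2 := C2.continuous
  have cl : Continuous (lap u) := by unfold lap; fun_prop
  -- angular derivative
  set T : ℝ → ℝ → ℝ := fun s θ =>
    -(cos θ * d1 u (a + s * cos θ, b + s * sin θ) + sin θ * d2 u (a + s * cos θ, b + s * sin θ))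
    - sin θ * (-(s * sin θ) * d1 (d1 u) (a + s * cos θ, b + s * sin θ)
        + s * cos θ * d2 (d1 u) (a + s * cos θ, b + s * sin θ))
    + cos θ * (-(s * sin θ) * d1 (d2 u) (a + s * cos θ, b + s * sin θ)
        + s * cos θ * d2 (d2 u) (a + s * cos θ, b + s * sin θ)) with hT
  have cT : Continuous (Function.uncurry T) := by
    simp only [hT, Function.uncurry_def]; fun_prop
  have hT0 : ∀ s, ∫ θ in (-π)..π, T s θ = 0 := by
    intro s
    rw [intervalIntegral.integral_eq_sub_of_hasDerivAt
      (f := fun θ => -(sin θ * d1 u (a + s * cos θ, b + s * sin θ)) +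
        cos θ * d2 u (a + s * cos θ, b + s * sin θ))]
    · simp
    · intro θ _
      have hp : HasDerivAt (fun θ => a + s * cos θ) (-(s * sin θ)) θ := by
        simpa using ((hasDerivAt_cos θ).const_mul s).const_add a
      have hq : HasDerivAt (fun θ => b + s * sin θ) (s * cos θ) θ := by
        simpa using ((hasDerivAt_sin θ).const_mul s).const_add b
      have h1 := curve_deriv C1 hp hq
      have h2 := curve_deriv C2 hp hq
      refine ((((hasDerivAt_sin θ).mul h1).neg).add ((hasDerivAt_cos θ).mul h2)).congr_deriv ?_
      simp only [hT]; ring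
    · exact (cT.comp (by fun_prop : Continuous fun θ : ℝ => (s, θ))).intervalIntegrable _ _
  have h : ∀ θ : ℝ, r * (cos θ * d1 u (a + r * cos θ, b + r * sin θ) +
        sin θ * d2 u (a + r * cos θ, b + r * sin θ)) =
      ∫ s in (0:ℝ)..r, (s * lap u (a + s * cos θ, b + s * sin θ) - T s θ) := by
    intro θ
    rw [intervalIntegral.integral_eq_sub_of_hasDerivAt
      (f := fun s => s * (cos θ * d1 u (a + s * cos θ, b + s * sin θ) +
        sin θ * d2 u (a + s * cos θ, b + s * sin θ)))]
    · simp
    · intro s _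
      have hp : HasDerivAt (fun s => a + s * cos θ) (cos θ) s := by
        simpa using ((hasDerivAt_id s).mul_const (cos θ)).const_add a
      have hq : HasDerivAt (fun s => b + s * sin θ) (sin θ) s := by
        simpa using ((hasDerivAt_id s).mul_const (sin θ)).const_add b
      have h1 := curve_deriv C1 hp hq
      have h2 := curve_deriv C2 hp hq
      refine ((hasDerivAt_id s).mul ((h1.const_mul (cos θ)).add
        (h2.const_mul (sin θ)))).congr_deriv ?_
      simp only [hT, lap, id, Pi.add_apply]
      have := sin_sq_add_cos_sq θ
      linear_combination (s * (d1 (d1 u) (a + s * cos θ, b + s * sin θ) +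
        d2 (d2 u) (a + s * cos θ, b + s * sin θ))) * this
    · have := cT.comp (by fun_prop : Continuous fun s : ℝ => (s, θ))
      simp only [Function.comp_def, Function.uncurry] at this
      exact Continuous.intervalIntegrable (by fun_prop) _ _
  rw [← intervalIntegral.integral_const_mul]
  simp only [h]
  have cT' : Continuous fun p : ℝ × ℝ => T p.1 p.2 := cT
  rw [← swap_cont (f := fun s θ => s * lap u (a + s * cos θ, b + s * sin θ) - T s θ)
    (by simp only [Function.uncurry_def]; fun_prop)]
  congr 1; ext s
  rw [intervalIntegral.integral_sub, hT0, intervalIntegral.integral_const_mul, sub_zero]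
  · exact Continuous.intervalIntegrable (by fun_prop) _ _
  · exact (cT.comp (by fun_prop : Continuous fun θ : ℝ => (s, θ))).intervalIntegrable _ _

lemma core {u : ℝ × ℝ → ℝ} (hu : ContDiff ℝ 2 u) (hp : Per u) (hm : (∫ x in Qd, u x) = 0)
    {G L : ℝ} (hG : 0 < G) (hGG : ∫ x in Qd, gradSq u x = G ^ 2)
    (hL : 4 * G ≤ L) (hLL : ∫ x in Qd, lap u x ^ 2 ≤ L ^ 2) (a b : ℝ) :
    2 * π * |u (a, b)| ≤ 39 / 2 * G + π * G * log (L / G) := by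
  have hu1 : ContDiff ℝ 1 u := hu.of_le (by norm_num)
  obtain ⟨C1, C2⟩ := d_contDiff hu
  obtain ⟨c11, c12⟩ := d_cont C1
  obtain ⟨c21, c22⟩ := d_cont C2
  obtain ⟨p1, p2⟩ := d_per hp
  have p11 := (d_per p1).1
  have p22 := (d_per p2).2
  have c1 := C1.continuous
  have c2 := C2.continuous
  have cu := hu.continuous
  have cl : Continuous (lap u) := by unfold lap; fun_prop
  have cg : Continuous (gradSq u) := by unfold gradSq; fun_prop
  have hpi := pi_pos
  have hpi4 := pi_lt_four
  have hL0 : 0 < L := by linarith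
  set P : ℝ → ℝ := fun s => ∫ θ in (-π)..π, (cos θ * d1 u (a + s * cos θ, b + s * sin θ) +
        sin θ * d2 u (a + s * cos θ, b + s * sin θ)) with hP
  set A : ℝ → ℝ := fun s => ∫ θ in (-π)..π, lap u (a + s * cos θ, b + s * sin θ) with hA
  set q : ℝ → ℝ := fun s => ∫ θ in (-π)..π, lap u (a + s * cos θ, b + s * sin θ) ^ 2 with hq
  set g : ℝ → ℝ := fun s => ∫ θ in (-π)..π, gradSq u (a + s * cos θ, b + s * sin θ) with hg
  set m : ℝ → ℝ := fun s => ∫ θ in (-π)..π, |u (a + s * cos θ, b + s * sin θ)| with hmm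
  have cP : Continuous P := cont_inner (f := fun s θ =>
    (cos θ * d1 u (a + s * cos θ, b + s * sin θ) +
        sin θ * d2 u (a + s * cos θ, b + s * sin θ))) (by fun_prop) _ _
  have cA : Continuous A := cont_inner (f := fun s θ =>
    lap u (a + s * cos θ, b + s * sin θ)) (by fun_prop) _ _
  have cq : Continuous q := cont_inner (f := fun s θ =>
    lap u (a + s * cos θ, b + s * sin θ) ^ 2) (by fun_prop) _ _
  have cgg : Continuous g := cont_inner (f := fun s θ =>
    gradSq u (a + s * cos θ, b + s * sin θ)) (by fun_prop) _ _
  have cm : Continuous m := cont_inner (f := fun s θ =>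
    |u (a + s * cos θ, b + s * sin θ)|) (by fun_prop) _ _
  have hle : (-π) ≤ π := by linarith
  have q0 : ∀ s, 0 ≤ q s := fun s =>
    intervalIntegral.integral_nonneg hle (fun _ _ => sq_nonneg _)
  have g0 : ∀ s, 0 ≤ g s := fun s =>
    intervalIntegral.integral_nonneg hle (fun _ _ => by unfold gradSq; positivity)
  have m0 : ∀ s, 0 ≤ m s := fun s =>
    intervalIntegral.integral_nonneg hle (fun _ _ => abs_nonneg _)
  have Iq : ∫ s in (0:ℝ)..(1/2), s * q s ≤ L ^ 2 := by
    refine (polar_torus (f := fun x => lap u x ^ 2) (by fun_prop) ?_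
      (fun x => sq_nonneg _) a b).trans hLL
    intro x
    simp only [lap, (p11 x).1, (p11 x).2, (p22 x).1, (p22 x).2, and_self]
  have Ig : ∫ s in (0:ℝ)..(1/2), s * g s ≤ G ^ 2 := by
    refine (polar_torus (f := gradSq u) cg ?_
      (fun x => by unfold gradSq; positivity) a b).trans hGG.le
    intro x
    simp only [gradSq, (p1 x).1, (p1 x).2, (p2 x).1, (p2 x).2, and_self]
  have Im : ∫ s in (0:ℝ)..(1/2), s * m s ≤ 3 / 2 * G := by
    refine (polar_torus (f := fun x => |u x|) (by fun_prop) ?_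
      (fun x => abs_nonneg _) a b).trans (poincare hu1 hm hG hGG)
    intro x
    simp only [(hp x).1, (hp x).2, and_self]
  have mono : ∀ {k : ℝ → ℝ}, Continuous k → (∀ s, 0 ≤ k s) → ∀ x y : ℝ, 0 ≤ x → x ≤ y → y ≤ 1/2 →
      ∫ s in x..y, s * k s ≤ ∫ s in (0:ℝ)..(1/2), s * k s := by
    intro k hk k0 x y hx hxy hy
    have ii : ∀ c d : ℝ, IntervalIntegrable (fun s => s * k s) volume c d := fun c d =>
      Continuous.intervalIntegrable (by fun_prop) _ _
    have e1 := intervalIntegral.integral_add_adjacent_intervals (ii 0 x) (ii x y)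
    have e2 := intervalIntegral.integral_add_adjacent_intervals (ii 0 y) (ii y (1/2))
    have n1 : 0 ≤ ∫ s in (0:ℝ)..x, s * k s :=
      intervalIntegral.integral_nonneg hx (fun s hs => mul_nonneg hs.1 (k0 s))
    have n2 : 0 ≤ ∫ s in y..(1/2), s * k s :=
      intervalIntegral.integral_nonneg hy
        (fun s hs => mul_nonneg (by linarith [hs.1]) (k0 s))
    linarith
  -- small radii
  have hP1 : ∀ r, 0 < r → r ≤ 1/2 → |P r| ≤ 3 * L := by
    intro r hr hr2
    have e : r * P r = ∫ s in (0:ℝ)..r, s * A s := radial_two hu a b r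
    have hμ : 0 < r / L := by positivity
    have b1 : |r * P r| ≤ ∫ s in (0:ℝ)..r, (r / L / 2 * (s * q s) + π / (r / L) * s) := by
      rw [e]
      refine (intervalIntegral.abs_integral_le_integral_abs hr.le).trans ?_
      apply intervalIntegral.integral_mono_on hr.le
      · exact Continuous.intervalIntegrable (by fun_prop) _ _
      · exact Continuous.intervalIntegrable (by fun_prop) _ _
      · intro s hs
        have := young_int (h := fun θ => lap u (a + s * cos θ, b + s * sin θ)) (by fun_prop) hμ
        rw [abs_mul, abs_of_nonneg hs.1]
        calc s * |A s| ≤ s * (r / L / 2 * q s + π / (r / L)) :=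
              mul_le_mul_of_nonneg_left this hs.1
          _ = _ := by ring
    rw [intervalIntegral.integral_add (Continuous.intervalIntegrable (by fun_prop) _ _)
      (Continuous.intervalIntegrable (by fun_prop) _ _), intervalIntegral.integral_const_mul,
      intervalIntegral.integral_const_mul, integral_id, abs_mul, abs_of_pos hr] at b1
    have b2 := (mono cq q0 0 r le_rfl hr.le hr2).trans Iq
    have b3 : r / L / 2 * (∫ s in (0:ℝ)..r, s * q s) ≤ r / L / 2 * L ^ 2 :=
      mul_le_mul_of_nonneg_left b2 (by positivity)
    have e3 : r / L / 2 * L ^ 2 = r * (L / 2) := by field_simp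
    have e4 : π / (r / L) * ((r ^ 2 - 0 ^ 2) / 2) = r * (π * L / 2) := by field_simp; ring
    rw [e4] at b1
    rw [e3] at b3
    have : r * |P r| ≤ r * (3 * L) := by nlinarith [mul_pos hr hL0]
    exact le_of_mul_le_mul_left this hr
  -- intermediate radii
  have hP2 : ∀ s, 0 < s → |P s| ≤ 1 / (2 * G) * (s * g s) + π * G * s⁻¹ := by
    intro s hs
    have hμ : 0 < s / G := by positivity
    have h1 := young_int (h := fun θ => cos θ * d1 u (a + s * cos θ, b + s * sin θ) +
        sin θ * d2 u (a + s * cos θ, b + s * sin θ)) (by fun_prop) hμ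
    have h2 : ∫ θ in (-π)..π, (cos θ * d1 u (a + s * cos θ, b + s * sin θ) +
        sin θ * d2 u (a + s * cos θ, b + s * sin θ)) ^ 2 ≤ g s := by
      apply intervalIntegral.integral_mono_on hle
      · exact Continuous.intervalIntegrable (by fun_prop) _ _
      · exact Continuous.intervalIntegrable (by fun_prop) _ _
      · intro θ _
        unfold gradSq
        generalize d1 u (a + s * cos θ, b + s * sin θ) = X
        generalize d2 u (a + s * cos θ, b + s * sin θ) = Y
        have h := sin_sq_add_cos_sq θ
        have : X ^ 2 + Y ^ 2 - (cos θ * X + sin θ * Y) ^ 2 = (sin θ * X - cos θ * Y) ^ 2 := by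
          linear_combination (-(X ^ 2 + Y ^ 2)) * h
        nlinarith [sq_nonneg (sin θ * X - cos θ * Y)]
    have h3 := mul_le_mul_of_nonneg_left h2 (by positivity : 0 ≤ s / G / 2)
    have e1 : s / G / 2 * g s = 1 / (2 * G) * (s * g s) := by field_simp
    have e2 : π / (s / G) = π * G * s⁻¹ := by field_simp
    rw [e2] at h1
    rw [e1] at h3
    exact h1.trans (by linarith)
  set δ : ℝ := G / L with hδ
  have hδ0 : 0 < δ := by positivity
  have hδ4 : δ ≤ 1/4 := by
    rw [hδ, div_le_iff₀ hL0]; linarith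
  set K : ℝ := 7 / 2 * G + π * G * log (L / G) with hK
  have hint : ∀ r, 1/4 ≤ r → r ≤ 1/2 → |∫ s in (0:ℝ)..r, P s| ≤ K := by
    intro r hr hr2
    have ii : ∀ c d : ℝ, IntervalIntegrable (fun s => |P s|) volume c d := fun c d =>
      Continuous.intervalIntegrable (by fun_prop) _ _
    refine (intervalIntegral.abs_integral_le_integral_abs (by linarith)).trans ?_
    rw [← intervalIntegral.integral_add_adjacent_intervals (ii 0 δ) (ii δ r)]
    have b1 : ∫ s in (0:ℝ)..δ, |P s| ≤ 3 * G := by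
      calc ∫ s in (0:ℝ)..δ, |P s| ≤ ∫ s in (0:ℝ)..δ, 3 * L := by
            apply intervalIntegral.integral_mono_on_of_le_Ioo hδ0.le (ii _ _)
              (Continuous.intervalIntegrable (by fun_prop) _ _)
            intro s hs
            exact hP1 s hs.1 (by linarith [hs.2])
        _ = 3 * G := by
            rw [intervalIntegral.integral_const, smul_eq_mul, hδ]; field_simp; ring
    have hinv : IntervalIntegrable (fun s : ℝ => s⁻¹) volume δ r := by
      apply ContinuousOn.intervalIntegrable
      apply ContinuousOn.inv₀ continuousOn_id
      intro s hs
      rw [uIcc_of_le (by linarith)] at hs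
      simp only [id]; linarith [hs.1]
    have hgi : IntervalIntegrable (fun s : ℝ => 1 / (2 * G) * (s * g s)) volume δ r :=
      Continuous.intervalIntegrable (by fun_prop) _ _
    have b2 : ∫ s in δ..r, |P s| ≤ G / 2 + π * G * log (L / G) := by
      calc ∫ s in δ..r, |P s| ≤ ∫ s in δ..r, (1 / (2 * G) * (s * g s) + π * G * s⁻¹) := by
            apply intervalIntegral.integral_mono_on (by linarith) (ii _ _)
              (hgi.add (hinv.const_mul _))
            intro s hs
            exact hP2 s (by linarith [hs.1])
        _ = 1 / (2 * G) * (∫ s in δ..r, s * g s) + π * G * log (r / δ) := by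
            rw [intervalIntegral.integral_add hgi (hinv.const_mul _),
              intervalIntegral.integral_const_mul, intervalIntegral.integral_const_mul,
              integral_inv_of_pos hδ0 (by linarith)]
        _ ≤ 1 / (2 * G) * G ^ 2 + π * G * log (L / G) := by
            have h1 := (mono cgg g0 δ r hδ0.le (by linarith) hr2).trans Ig
            have h2 : log (r / δ) ≤ log (L / G) := by
              apply log_le_log (by have : 0 < r := by linarith
                                   positivity)
              rw [hδ, show r / (G / L) = r * (L / G) by field_simp]
              have : 0 < L / G := by positivity
              nlinarith
            gcongr
        _ = _ := by field_simp
    rw [hK]; linarith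
  have hpt : ∀ r, 1/4 ≤ r → r ≤ 1/2 → 2 * π * |u (a, b)| - K ≤ m r := by
    intro r hr hr2
    have e : ∫ θ in (-π)..π, u (a + r * cos θ, b + r * sin θ) = 2 * π * u (a, b) +
      ∫ s in (0:ℝ)..r, P s := radial_one hu1 a b r
    have h1 : |∫ θ in (-π)..π, u (a + r * cos θ, b + r * sin θ)| ≤ m r :=
      intervalIntegral.abs_integral_le_integral_abs hle
    have h2 := hint r hr hr2
    have e2 : 2 * π * u (a, b) = (∫ θ in (-π)..π, u (a + r * cos θ, b + r * sin θ)) -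
      ∫ s in (0:ℝ)..r, P s := by linarith
    have h3 := abs_sub (∫ θ in (-π)..π, u (a + r * cos θ, b + r * sin θ)) (∫ s in (0:ℝ)..r, P s)
    rw [← e2, abs_mul, abs_of_pos (by positivity : 0 < 2 * π)] at h3
    linarith
  have hfin : ∫ s in (1/4:ℝ)..(1/2), (2 * π * |u (a, b)| - K) * s ≤ 3 / 2 * G := by
    refine le_trans ?_ ((mono cm m0 (1/4) (1/2) (by norm_num) (by norm_num) le_rfl).trans Im)
    apply intervalIntegral.integral_mono_on (by norm_num)
    · exact Continuous.intervalIntegrable (by fun_prop) _ _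
    · exact Continuous.intervalIntegrable (by fun_prop) _ _
    · intro s hs
      rw [mul_comm]
      exact mul_le_mul_of_nonneg_left (hpt s hs.1 hs.2) (by linarith [hs.1])
  rw [intervalIntegral.integral_const_mul, integral_id] at hfin
  rw [hK] at hfin
  linarith

end main

/-- **Logarithmic L^∞ embedding on `T²`** (Lemma 4.1): for any zero-mean `u ∈ H²(T²)`
with `∇u ≢ 0`, `‖u‖_∞ ≤ C ‖∇u‖_{L²} (1 + |log(‖Δu‖_{L²}/‖∇u‖_{L²})|)`. -/
theorem log_Linfty_embedding :
    ∃ C : ℝ, 0 < C ∧ ∀ u : ℝ × ℝ → ℝ, ContDiff ℝ 2 u → Per u →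
      (∫ x in Qd, u x) = 0 →
      Real.sqrt (∫ x in Qd, gradSq u x) ≠ 0 →
      (⨆ x : ℝ × ℝ, |u x|) ≤
        C * Real.sqrt (∫ x in Qd, gradSq u x) *
          (1 + |Real.log (Real.sqrt (∫ x in Qd, (lap u x) ^ 2) /
              Real.sqrt (∫ x in Qd, gradSq u x))|) := by
  refine ⟨100, by norm_num, ?_⟩
  intro u hu hp hm hG0
  set G := Real.sqrt (∫ x in Qd, gradSq u x) with hGdef
  set Λ := Real.sqrt (∫ x in Qd, (lap u x) ^ 2) with hΛdef
  have hG : 0 < G := lt_of_le_of_ne (Real.sqrt_nonneg _) (Ne.symm hG0)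
  have hΛ : 0 ≤ Λ := Real.sqrt_nonneg _
  have hGG : ∫ x in Qd, gradSq u x = G ^ 2 := by
    rw [hGdef, Real.sq_sqrt]
    exact integral_nonneg (fun x => by unfold gradSq; positivity)
  have hΛΛ : ∫ x in Qd, lap u x ^ 2 = Λ ^ 2 := by
    rw [hΛdef, Real.sq_sqrt]
    exact integral_nonneg (fun x => by positivity)
  apply ciSup_le
  rintro ⟨a, b⟩
  have hc := core hu hp hm hG hGG (le_max_right Λ (4 * G))
    (hΛΛ.le.trans (pow_le_pow_left₀ hΛ (le_max_left Λ (4 * G)) 2)) a b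
  have hlog : Real.log (max Λ (4 * G) / G) ≤ 4 + |Real.log (Λ / G)| := by
    rcases le_total Λ (4 * G) with h | h
    · rw [max_eq_right h, mul_div_assoc, div_self hG.ne', mul_one]
      have := Real.log_le_sub_one_of_pos (show (0:ℝ) < 4 by norm_num)
      linarith [abs_nonneg (Real.log (Λ / G))]
    · rw [max_eq_left h]
      linarith [le_abs_self (Real.log (Λ / G))]
  have hpi := Real.pi_gt_three
  have hpi4 := Real.pi_lt_four
  set l := |Real.log (Λ / G)| with hl
  have hl0 : 0 ≤ l := abs_nonneg _
  have h1 : π * G * Real.log (max Λ (4 * G) / G) ≤ π * G * (4 + l) :=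
    mul_le_mul_of_nonneg_left hlog (by positivity)
  have h2 : π * (G * (4 + l)) ≤ 4 * (G * (4 + l)) :=
    mul_le_mul_of_nonneg_right hpi4.le (by positivity)
  have h3 : 2 * 3 * |u (a, b)| ≤ 2 * π * |u (a, b)| := by gcongr
  have h4 : 0 ≤ G * l := by positivity
  nlinarith
end
end

section
/- Let u ∈ H^1(T^2) where T^2 has unit measure, and set m = ∫_{T^2} u² dx. Then ∫_{T^2} u² log(u²/m) dx ≤ C ∫_{T^2} |∇u|² dx for a universal constant C (logarithmic Sobolev inequality on the torus). -/
open MeasureTheory Real Set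

noncomputable section

/-- Lebesgue measure on the unit interval. -/
def muI : Measure ℝ := volume.restrict (Set.Ioc 0 1)

instance muI_prob : IsProbabilityMeasure muI := by
  refine ⟨?_⟩
  simp [muI]

lemma vol_Qd : (volume : Measure (ℝ × ℝ)).restrict Qd = muI.prod muI := by
  rw [muI, Measure.prod_restrict]; rfl

lemma integrable_muI {f : ℝ → ℝ} (hf : Continuous f) : Integrable f muI := by
  have : IntegrableOn f (Set.Icc 0 1) := hf.continuousOn.integrableOn_compact isCompact_Icc
  exact this.mono_set Set.Ioc_subset_Icc_self

lemma integrable_nu {f : ℝ × ℝ → ℝ} (hf : Continuous f) : Integrable f (muI.prod muI) := by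
  rw [← vol_Qd]
  have : IntegrableOn f (Set.Icc 0 1 ×ˢ Set.Icc 0 1) :=
    hf.continuousOn.integrableOn_compact (isCompact_Icc.prod isCompact_Icc)
  exact this.mono_set (Set.prod_mono Set.Ioc_subset_Icc_self Set.Ioc_subset_Icc_self)

/-- One-dimensional oscillation bound. -/
lemma osc_le {g g' : ℝ → ℝ} (hg : ∀ x, HasDerivAt g (g' x) x) (hc : Continuous g')
    {s t : ℝ} (hs : s ∈ Set.Ioc (0 : ℝ) 1) (ht : t ∈ Set.Ioc (0 : ℝ) 1) :
    |g s - g t| ≤ ∫ r, |g' r| ∂muI := by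
  have h1 : ∫ r in t..s, g' r = g s - g t :=
    intervalIntegral.integral_eq_sub_of_hasDerivAt (fun x _ => hg x)
      (hc.intervalIntegrable _ _)
  rw [← h1]
  have h2 := intervalIntegral.norm_integral_le_integral_norm_uIoc (f := g') (a := t) (b := s)
    (μ := volume)
  simp only [Real.norm_eq_abs] at h2
  refine h2.trans ?_
  refine setIntegral_mono_set (integrable_muI hc.abs) (Filter.Eventually.of_forall fun x => abs_nonneg _) ?_
  refine Filter.Eventually.of_forall fun x hx => ?_
  have hx' : x ∈ Set.uIoc t s := hx
  rw [Set.mem_uIoc] at hx'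
  show x ∈ Set.Ioc (0 : ℝ) 1
  rcases hx' with h | h
  · exact ⟨ht.1.trans h.1, h.2.trans hs.2⟩
  · exact ⟨hs.1.trans h.1, h.2.trans ht.2⟩

lemma cont_param {f : ℝ × ℝ → ℝ} (hf : Continuous f) :
    Continuous fun y => ∫ x, f (y, x) ∂muI := by
  have : (fun y => ∫ x, f (y, x) ∂muI) = fun y => ∫ x in (0 : ℝ)..1, f (y, x) := by
    funext y
    rw [intervalIntegral.integral_of_le zero_le_one]; rfl
  rw [this]
  exact intervalIntegral.continuous_parametric_intervalIntegral_of_continuous' (by exact hf) 0 1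

lemma ae_nu : ∀ᵐ p ∂(muI.prod muI), p.1 ∈ Set.Ioc (0 : ℝ) 1 ∧ p.2 ∈ Set.Ioc (0 : ℝ) 1 := by
  rw [← vol_Qd]
  exact ae_restrict_mem (measurableSet_Ioc.prod measurableSet_Ioc)

/-- The embedding of `W^{1,1}` in `L²` in dimension two. -/
lemma var_le {f f1 f2 : ℝ × ℝ → ℝ} (hf : Continuous f) (h1c : Continuous f1) (h2c : Continuous f2)
    (h1 : ∀ x y, HasDerivAt (fun s => f (s, y)) (f1 (x, y)) x)
    (h2 : ∀ x y, HasDerivAt (fun s => f (x, s)) (f2 (x, y)) y) :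
    2 * (∫ p, f p ^ 2 ∂(muI.prod muI)) - 2 * (∫ p, f p ∂(muI.prod muI)) ^ 2 ≤
      ((∫ p, |f1 p| ∂(muI.prod muI)) + ∫ p, |f2 p| ∂(muI.prod muI)) ^ 2 := by
  set ν := muI.prod muI with hν
  set A : ℝ → ℝ := fun y => ∫ x, |f1 (x, y)| ∂muI with hA
  set B : ℝ → ℝ := fun x => ∫ y, |f2 (x, y)| ∂muI with hB
  have cA : Continuous A := cont_param (f := fun q => |f1 (q.2, q.1)|) (by fun_prop)
  have cB : Continuous B := cont_param (f := fun q => |f2 q|) (by fun_prop)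
  set a := ∫ p, |f1 p| ∂ν with ha
  set b := ∫ p, |f2 p| ∂ν with hb
  have hAa : ∫ p, A p.2 ∂ν = a := by
    rw [ha, hν, integral_prod_symm _ (integrable_nu h1c.abs),
      integral_prod_symm _ (integrable_nu (f := fun p => A p.2) (by fun_prop))]
    simp [hA]
  have hBb : ∫ p, B p.1 ∂ν = b := by
    rw [hb, hν, integral_prod _ (integrable_nu h2c.abs),
      integral_prod _ (integrable_nu (f := fun p => B p.1) (by fun_prop))]
    simp [hB]
  have hA1 : ∫ y, A y ∂muI = a := by
    rw [ha, hν, integral_prod_symm _ (integrable_nu h1c.abs)]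
  have hB1 : ∫ y, B y ∂muI = b := by
    rw [hb, hν, integral_prod _ (integrable_nu h2c.abs)]
  have hAB : ∫ p, B p.1 * A p.2 ∂ν = b * a := by
    rw [hν, integral_prod_mul, hA1, hB1]
  set M := ∫ p, f p ∂ν with hM
  set N := ∫ p, f p ^ 2 ∂ν with hN
  have key : ∀ p : ℝ × ℝ, p.1 ∈ Set.Ioc (0 : ℝ) 1 ∧ p.2 ∈ Set.Ioc (0 : ℝ) 1 →
      ∀ q : ℝ × ℝ, q.1 ∈ Set.Ioc (0 : ℝ) 1 ∧ q.2 ∈ Set.Ioc (0 : ℝ) 1 →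
      (f p - f q) ^ 2 ≤ (A p.2 + B q.1) * (B p.1 + A q.2) := by
    rintro ⟨x, y⟩ ⟨hx, hy⟩ ⟨x', y'⟩ ⟨hx', hy'⟩
    simp only at hx hy hx' hy' ⊢
    have e1 : |f (x, y) - f (x', y)| ≤ A y :=
      osc_le (fun t => h1 t y) (by fun_prop) hx hx'
    have e2 : |f (x', y) - f (x', y')| ≤ B x' :=
      osc_le (fun t => h2 x' t) (by fun_prop) hy hy'
    have e3 : |f (x, y) - f (x, y')| ≤ B x :=
      osc_le (fun t => h2 x t) (by fun_prop) hy hy'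
    have e4 : |f (x, y') - f (x', y')| ≤ A y' :=
      osc_le (fun t => h1 t y') (by fun_prop) hx hx'
    have t1 := (abs_sub_le (f (x, y)) (f (x', y)) (f (x', y'))).trans (add_le_add e1 e2)
    have t2 := (abs_sub_le (f (x, y)) (f (x, y')) (f (x', y'))).trans (add_le_add e3 e4)
    rw [← sq_abs, sq]
    exact mul_le_mul t1 t2 (abs_nonneg _) ((abs_nonneg _).trans t1)
  have inner : ∀ p : ℝ × ℝ, p.1 ∈ Set.Ioc (0 : ℝ) 1 ∧ p.2 ∈ Set.Ioc (0 : ℝ) 1 →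
      f p ^ 2 - 2 * M * f p + N ≤ B p.1 * A p.2 + a * A p.2 + b * B p.1 + b * a := by
    intro p hp
    have hmono : ∫ q, (f p - f q) ^ 2 ∂ν ≤ ∫ q, (A p.2 + B q.1) * (B p.1 + A q.2) ∂ν := by
      refine integral_mono_ae (integrable_nu (by fun_prop)) (integrable_nu (by fun_prop)) ?_
      filter_upwards [ae_nu] with q hq using key p hp q hq
    have l : ∫ q, (f p - f q) ^ 2 ∂ν = f p ^ 2 - 2 * M * f p + N := by
      have : ∀ q, (f p - f q) ^ 2 = f p ^ 2 - (2 * f p) * f q + f q ^ 2 := fun q => by ring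
      simp_rw [this]
      rw [integral_add (integrable_nu (by fun_prop)) (integrable_nu (by fun_prop)),
        integral_sub (integrable_nu (by fun_prop)) (integrable_nu (by fun_prop)),
        integral_const_mul, integral_const]
      simp only [probReal_univ, smul_eq_mul]
      ring
    have r : ∫ q, (A p.2 + B q.1) * (B p.1 + A q.2) ∂ν
        = B p.1 * A p.2 + a * A p.2 + b * B p.1 + b * a := by
      have : ∀ q : ℝ × ℝ, (A p.2 + B q.1) * (B p.1 + A q.2)
          = A p.2 * B p.1 + A p.2 * A q.2 + B p.1 * B q.1 + B q.1 * A q.2 := fun q => by ring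
      simp_rw [this]
      rw [integral_add (integrable_nu (by fun_prop)) (integrable_nu (by fun_prop)),
        integral_add (integrable_nu (by fun_prop)) (integrable_nu (by fun_prop)),
        integral_add (integrable_nu (by fun_prop)) (integrable_nu (by fun_prop)),
        integral_const, integral_const_mul, integral_const_mul, hAa, hBb, hAB]
      simp only [probReal_univ, smul_eq_mul]
      ring
    rwa [l, r] at hmono
  have outer : ∫ p, (f p ^ 2 - 2 * M * f p + N) ∂ν
      ≤ ∫ p, (B p.1 * A p.2 + a * A p.2 + b * B p.1 + b * a) ∂ν := by
    refine integral_mono_ae (integrable_nu (by fun_prop)) (integrable_nu (by fun_prop)) ?_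
    filter_upwards [ae_nu] with q hq using inner q hq
  rw [integral_add (integrable_nu (by fun_prop)) (integrable_nu (by fun_prop)),
    integral_sub (integrable_nu (by fun_prop)) (integrable_nu (by fun_prop)),
    integral_const_mul, integral_const,
    integral_add (integrable_nu (by fun_prop)) (integrable_nu (by fun_prop)),
    integral_add (integrable_nu (by fun_prop)) (integrable_nu (by fun_prop)),
    integral_add (integrable_nu (by fun_prop)) (integrable_nu (by fun_prop)),
    integral_const_mul, integral_const_mul, integral_const, hAa, hBb, hAB] at outer
  simp only [probReal_univ, smul_eq_mul] at outer
  nlinarith [outer]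

/-- Cauchy-Schwarz. -/
lemma cs_nu {g h : ℝ × ℝ → ℝ} (hg : Continuous g) (hh : Continuous h) :
    (∫ p, |g p * h p| ∂(muI.prod muI)) ^ 2 ≤
      (∫ p, g p ^ 2 ∂(muI.prod muI)) * ∫ p, h p ^ 2 ∂(muI.prod muI) := by
  set I := ∫ p, |g p * h p| ∂(muI.prod muI) with hI
  set P := ∫ p, g p ^ 2 ∂(muI.prod muI) with hP
  set Q := ∫ p, h p ^ 2 ∂(muI.prod muI) with hQ
  have q : ∀ t : ℝ, 0 ≤ P * (t * t) + (2 * I) * t + Q := by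
    intro t
    have h0 : 0 ≤ ∫ p, (t * |g p| + |h p|) ^ 2 ∂(muI.prod muI) :=
      integral_nonneg fun p => sq_nonneg _
    have e : ∀ p, (t * |g p| + |h p|) ^ 2 = (t * t) * g p ^ 2 + (2 * t) * |g p * h p| + h p ^ 2 := by
      intro p
      rw [abs_mul, ← sq_abs (g p), ← sq_abs (h p)]; ring
    simp_rw [e] at h0
    rw [integral_add (integrable_nu (by fun_prop)) (integrable_nu (by fun_prop)),
      integral_add (integrable_nu (by fun_prop)) (integrable_nu (by fun_prop)),
      integral_const_mul, integral_const_mul] at h0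
    linarith
  have := discrim_le_zero q
  rw [discrim] at this
  nlinarith

/-- **Logarithmic Sobolev inequality on `T²`** (Lemma 4.8): for `u ∈ H¹(T²)` with
`m = ∫ u²`, one has `∫ u² log(u²/m) ≤ C ∫ |∇u|²` for a universal constant `C`. -/
theorem log_sobolev_torus :
    ∃ C : ℝ, 0 < C ∧ ∀ u : ℝ × ℝ → ℝ, ContDiff ℝ 1 u → Per u →
      (∫ x in Qd, (u x) ^ 2 * Real.log ((u x) ^ 2 / ∫ y in Qd, (u y) ^ 2))
        ≤ C * ∫ x in Qd, gradSq u x := by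
  refine ⟨4, by norm_num, fun u hu _ => ?_⟩
  have cu : Continuous u := hu.continuous
  have c1 : Continuous (d1 u) := (hu.continuous_fderiv one_ne_zero).clm_apply continuous_const
  have c2 : Continuous (d2 u) := (hu.continuous_fderiv one_ne_zero).clm_apply continuous_const
  have hd : ∀ p, HasFDerivAt u (fderiv ℝ u p) p := fun p =>
    (hu.differentiable one_ne_zero p).hasFDerivAt
  rw [vol_Qd]
  set ν := muI.prod muI with hν
  set m := ∫ y, u y ^ 2 ∂ν with hm
  have hm0 : 0 ≤ m := integral_nonneg fun p => sq_nonneg _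
  have hG : ∫ x, gradSq u x ∂ν = (∫ x, d1 u x ^ 2 ∂ν) + ∫ x, d2 u x ^ 2 ∂ν :=
    integral_add (integrable_nu (by fun_prop)) (integrable_nu (by fun_prop))
  have hG0 : 0 ≤ ∫ x, gradSq u x ∂ν :=
    integral_nonneg fun p => add_nonneg (sq_nonneg _) (sq_nonneg _)
  rcases hm0.eq_or_lt with h | hmpos
  · rw [← h]; simpa using hG0
  have hx : ∀ x y, HasDerivAt (fun s => u (s, y)) (d1 u (x, y)) x := fun x y =>
    (hd (x, y)).comp_hasDerivAt x ((hasDerivAt_id x).prodMk (hasDerivAt_const x y))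
  have hy : ∀ x y, HasDerivAt (fun s => u (x, s)) (d2 u (x, y)) y := fun x y =>
    (hd (x, y)).comp_hasDerivAt y ((hasDerivAt_const y x).prodMk (hasDerivAt_id y))
  have V := var_le (f := fun p => u p ^ 2) (f1 := fun p => 2 * (u p * d1 u p))
    (f2 := fun p => 2 * (u p * d2 u p)) (by fun_prop) (by fun_prop) (by fun_prop)
    (fun x y => by
      refine ((hx x y).fun_pow 2).congr_deriv ?_
      push_cast
      ring)
    (fun x y => by
      refine ((hy x y).fun_pow 2).congr_deriv ?_
      push_cast
      ring)
  simp only [abs_mul (2 : ℝ), integral_const_mul] at V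
  rw [← hν, ← hm, abs_of_pos (two_pos : (0 : ℝ) < 2)] at V
  have k1 := cs_nu cu c1
  have k2 := cs_nu cu c2
  rw [← hν, ← hm] at k1 k2
  set a := ∫ p, |u p * d1 u p| ∂ν
  set b := ∫ p, |u p * d2 u p| ∂ν
  set S := ∫ p, (u p ^ 2) ^ 2 ∂ν with hS
  have hvar : S - m ^ 2 ≤ 4 * m * ∫ x, gradSq u x ∂ν := by
    rw [hG]; nlinarith [sq_nonneg (a - b)]
  have hint : Integrable (fun x => u x ^ 2 * Real.log (u x ^ 2 / m)) ν := by
    have hc : Continuous fun x => m * ((u x ^ 2 / m) * Real.log (u x ^ 2 / m)) :=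
      continuous_const.mul (Real.continuous_mul_log.comp (by fun_prop : Continuous fun x => u x ^ 2 / m))
    refine (integrable_nu hc).congr (Filter.Eventually.of_forall fun x => ?_)
    simp only
    field_simp
  have hent : ∫ x, u x ^ 2 * Real.log (u x ^ 2 / m) ∂ν ≤
      ∫ x, ((1 / m) * (u x ^ 2) ^ 2 - u x ^ 2) ∂ν := by
    refine integral_mono hint (integrable_nu (by fun_prop)) fun x => ?_
    simp only
    rcases (sq_nonneg (u x)).eq_or_lt with h | h
    · rw [← h]; simp
    · have := Real.log_le_sub_one_of_pos (div_pos h hmpos)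
      have := mul_le_mul_of_nonneg_left this h.le
      refine this.trans (le_of_eq ?_)
      ring
  rw [integral_sub (integrable_nu (by fun_prop)) (integrable_nu (by fun_prop)),
    integral_const_mul, ← hS, ← hm] at hent
  refine hent.trans ?_
  rw [one_div, inv_mul_eq_div, sub_le_iff_le_add, div_le_iff₀ hmpos]
  nlinarith
end
end
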